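/- Convolution-type kernels belong to sL²: Let T > 0, d₁, d₂ ∈ ℕ, f₁ ∈ L²((0,T); ℝ) and f₂ : (0,T) → ℝ^{d₁×d₂} measurable and essentially bounded. Define f(t,s) := f₁(t−s) f₂(s) for (t,s) ∈ △₂(0,T). Then f ∈ sL²(△₂(0,T); ℝ^{d₁×d₂}): f is square integrable on △₂(0,T), ess sup_{t∈(0,T)} (∫_t^T |f(s,t)|² ds)^{1/2} < ∞, and for every ε > 0 there is a finite partition 0 = U₀ < U₁ < ⋯ < U_m = T such that ess sup_{t∈(U_i,U_{i+1})} (∫_t^{U_{i+1}} |f(s,t)|² ds)^{1/2} < ε for each i ∈ {0,…,m−1}. -/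

import Mathlib

open MeasureTheory Set Matrix

attribute [local instance] Matrix.frobeniusSeminormedAddCommGroup
  Matrix.frobeniusNormedAddCommGroup Matrix.frobeniusNormedSpace

instance (m n : ℕ) : MeasurableSpace (Matrix (Fin m) (Fin n) ℝ) :=
  inferInstanceAs (MeasurableSpace (Fin m → Fin n → ℝ))

/-- The open triangle `△₂(0,T) = {(t,s) : 0 < s < t < T}` (first coordinate larger). -/
def tri (T : ℝ) : Set (ℝ × ℝ) := {p : ℝ × ℝ | 0 < p.2 ∧ p.2 < p.1 ∧ p.1 < T}

/-- The `sL²(△₂(0,T))` norm: `ess sup_{t ∈ (0,T)} (∫_t^T |f(s,t)|² ds)^{1/2}`. -/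
noncomputable def sl2norm (T : ℝ) {d₁ d₂ : ℕ}
    (f : ℝ → ℝ → Matrix (Fin d₁) (Fin d₂) ℝ) : ℝ :=
  essSup (fun t => Real.sqrt (∫ s in Set.Ioo t T, ‖f s t‖ ^ 2))
    (volume.restrict (Set.Ioo 0 T))

/-- Membership in `sL²(△₂(0,T); ℝ^{d₁×d₂})`: measurability, square integrability on the
triangle, essential boundedness of `t ↦ (∫_t^T |f(s,t)|² ds)^{1/2}`, and the partition
property: for every `ε > 0` there is a finite partition `0 = U₀ < ⋯ < U_m = T` with
`ess sup_{t ∈ (Uᵢ, Uᵢ₊₁)} (∫_t^{Uᵢ₊₁} |f(s,t)|² ds)^{1/2} < ε` for each `i`. -/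
def MemSL2 (T : ℝ) {d₁ d₂ : ℕ} (f : ℝ → ℝ → Matrix (Fin d₁) (Fin d₂) ℝ) : Prop :=
  (Measurable fun p : ℝ × ℝ => f p.1 p.2) ∧
    MeasureTheory.IntegrableOn (fun p : ℝ × ℝ => ‖f p.1 p.2‖ ^ 2) (tri T) ∧
    (∃ C, ∀ᵐ t ∂(volume.restrict (Set.Ioo 0 T)),
      Real.sqrt (∫ s in Set.Ioo t T, ‖f s t‖ ^ 2) ≤ C) ∧
    (∀ ε > 0, ∃ (m : ℕ) (U : ℕ → ℝ), U 0 = 0 ∧ U m = T ∧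
      (∀ i < m, U i < U (i + 1)) ∧
      ∀ i < m, ∃ c < ε, ∀ᵐ t ∂(volume.restrict (Set.Ioo (U i) (U (i + 1)))),
        Real.sqrt (∫ s in Set.Ioo t (U (i + 1)), ‖f s t‖ ^ 2) ≤ c)

theorem measurable_matrix_apply {m n : ℕ} (i : Fin m) (j : Fin n) :
    Measurable fun A : Matrix (Fin m) (Fin n) ℝ => A i j :=
  (measurable_pi_apply j).comp (measurable_pi_apply (X := fun _ : Fin m => Fin n → ℝ) i)

theorem measurable_frobenius_norm {m n : ℕ} :
    Measurable fun A : Matrix (Fin m) (Fin n) ℝ => ‖A‖ := by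
  simp only [Matrix.frobenius_norm_def]
  exact (Finset.measurable_sum _ fun i _ => Finset.measurable_sum _ fun j _ =>
    (measurable_matrix_apply i j).norm.pow_const _).pow_const _

theorem measurable_matrix_smul {X : Type*} [MeasurableSpace X] {m n : ℕ} {f : X → ℝ}
    {g : X → Matrix (Fin m) (Fin n) ℝ} (hf : Measurable f) (hg : Measurable g) :
    Measurable fun x => f x • g x := by
  refine measurable_pi_lambda (X := fun _ : Fin m => Fin n → ℝ) _ fun i =>
    measurable_pi_lambda _ fun j => ?_
  exact hf.mul ((measurable_matrix_apply i j).comp hg)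

/-- Translating the variable bounds the section integrals of a convolution-type kernel. -/
theorem sqrt_setIntegral_convolution_kernel_le {E : Type*} [SeminormedAddCommGroup E]
    [NormedSpace ℝ E] {f : ℝ → ℝ} {δ C : ℝ}
    (hf : IntegrableOn (fun u => f u ^ 2) (Ioo 0 δ)) {t r : ℝ} (hr : r - t ≤ δ) {A : E}
    (hA : ‖A‖ ≤ C) :
    √(∫ s in Ioo t r, ‖f (s - t) • A‖ ^ 2) ≤ √(C ^ 2 * ∫ u in Ioo 0 δ, f u ^ 2) := by
  apply Real.sqrt_le_sqrt
  have hpre : (fun s => s - t) ⁻¹' Ioo 0 (r - t) = Ioo t r := by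
    ext s; simp
  have htrans : ∫ s in Ioo t r, f (s - t) ^ 2 = ∫ u in Ioo 0 (r - t), f u ^ 2 := by
    rw [← hpre]
    exact (measurePreserving_sub_right volume t).setIntegral_preimage_emb
      (MeasurableEquiv.subRight t).measurableEmbedding (fun u => f u ^ 2) _
  simp_rw [norm_smul, mul_pow, Real.norm_eq_abs, sq_abs]
  rw [integral_mul_const, htrans, mul_comm]
  have hmono : ∫ u in Ioo 0 (r - t), f u ^ 2 ≤ ∫ u in Ioo 0 δ, f u ^ 2 :=
    setIntegral_mono_set hf (ae_of_all _ fun u => sq_nonneg (f u))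
      (Ioo_subset_Ioo_right hr).eventuallyLE
  gcongr

theorem tendsto_setIntegral_Ioo_div_add_one {f : ℝ → ℝ} {T : ℝ} (hT : 0 ≤ T)
    (hf : IntegrableOn f (Ioo 0 T)) :
    Filter.Tendsto (fun n : ℕ => ∫ u in Ioo 0 (T / (n + 1)), f u) Filter.atTop (nhds 0) := by
  have hanti : Antitone fun n : ℕ => Ioo 0 (T / ((n : ℝ) + 1)) := fun a b hab =>
    Ioo_subset_Ioo_right (by gcongr)
  have hempty : ⋂ n : ℕ, Ioo 0 (T / ((n : ℝ) + 1)) = ∅ := by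
    refine eq_empty_of_forall_notMem fun x hx => ?_
    rw [mem_iInter] at hx
    obtain ⟨n, hn⟩ := exists_nat_gt (T / x)
    have hx0 : 0 < x := (hx 0).1
    have h := (hx n).2
    rw [lt_div_iff₀ (by positivity)] at h
    rw [div_lt_iff₀ hx0] at hn
    nlinarith
  have h := tendsto_setIntegral_of_antitone (μ := volume) (f := f)
    (fun n : ℕ => measurableSet_Ioo) hanti ⟨0, by simpa using hf⟩
  simpa [hempty] using h

theorem integrableOn_tri_convolution {f g : ℝ → ℝ} {T : ℝ} (hf : IntegrableOn f (Ioo 0 T))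
    (hg : IntegrableOn g (Ioo 0 T)) :
    IntegrableOn (fun p : ℝ × ℝ => f (p.1 - p.2) * g p.2) (tri T) := by
  have htri : MeasurableSet (tri T) :=
    (measurableSet_lt measurable_const measurable_snd).inter
      ((measurableSet_lt measurable_snd measurable_fst).inter
        (measurableSet_lt measurable_fst measurable_const))
  have h := ((integrable_indicator_iff measurableSet_Ioo).2 hg).convolution_integrand
    (ContinuousLinearMap.mul ℝ ℝ) ((integrable_indicator_iff measurableSet_Ioo).2 hf)
  refine (h.integrableOn (s := tri T)).congr_fun (fun p hp => ?_) htri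
  obtain ⟨h0, h1, h2⟩ := hp
  have hs : p.2 ∈ Ioo 0 T := ⟨h0, h1.trans h2⟩
  have hd : p.1 - p.2 ∈ Ioo 0 T := ⟨by linarith, by linarith⟩
  simp [indicator_of_mem hs, indicator_of_mem hd, mul_comm]

/-- **Convolution-type kernels belong to `sL²`.** If `f₁ ∈ L²((0,T); ℝ)` and
`f₂ : (0,T) → ℝ^{d₁×d₂}` is measurable and essentially bounded, then the kernel
`f(t,s) := f₁(t-s) f₂(s)` belongs to `sL²(△₂(0,T); ℝ^{d₁×d₂})`. -/
theorem convolution_kernel_mem_sL2 {T : ℝ} (hT : 0 < T) {d₁ d₂ : ℕ}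
    (f₁ : ℝ → ℝ) (hf₁m : Measurable f₁)
    (hf₁L2 : MeasureTheory.IntegrableOn (fun u => (f₁ u) ^ 2) (Set.Ioo 0 T))
    (f₂ : ℝ → Matrix (Fin d₁) (Fin d₂) ℝ) (hf₂m : Measurable f₂)
    (hf₂b : ∃ C, ∀ᵐ s ∂(volume.restrict (Set.Ioo 0 T)), ‖f₂ s‖ ≤ C) :
    MemSL2 T (fun t s => f₁ (t - s) • f₂ s) := by
  obtain ⟨C, hC⟩ := hf₂b
  refine ⟨?_, ?_, ?_, ?_⟩
  · exact measurable_matrix_smul (hf₁m.comp (measurable_fst.sub measurable_snd))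
      (hf₂m.comp measurable_snd)
  · have hg : IntegrableOn (fun s => ‖f₂ s‖ ^ 2) (Ioo 0 T) := by
      refine Measure.integrableOn_of_bounded (M := C ^ 2) (by simp)
        ((measurable_frobenius_norm.comp hf₂m).pow_const 2).aestronglyMeasurable ?_
      filter_upwards [hC] with s hs
      rw [norm_pow, norm_norm]
      gcongr
    refine (integrableOn_tri_convolution hf₁L2 hg).congr (ae_of_all _ fun p => ?_)
    simp [norm_smul, mul_pow]
  · refine ⟨√(C ^ 2 * ∫ u in Ioo 0 T, f₁ u ^ 2), ?_⟩
    filter_upwards [hC, ae_restrict_mem measurableSet_Ioo] with t ht htT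
    exact sqrt_setIntegral_convolution_kernel_le hf₁L2 (by linarith [htT.1]) ht
  · intro ε hε
    have hlim : Filter.Tendsto
        (fun n : ℕ => √(C ^ 2 * ∫ u in Ioo 0 (T / ((n : ℝ) + 1)), f₁ u ^ 2))
        Filter.atTop (nhds 0) := by
      simpa using ((tendsto_setIntegral_Ioo_div_add_one hT.le hf₁L2).const_mul (C ^ 2)).sqrt
    obtain ⟨n, hn⟩ := (hlim.eventually (gt_mem_nhds hε)).exists
    set δ : ℝ := T / ((n : ℝ) + 1) with hδ
    have hδ0 : 0 < δ := by positivity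
    have hnδ : ((n : ℝ) + 1) * δ = T := by rw [hδ]; field_simp
    have hδT : δ ≤ T := by nlinarith [(Nat.cast_nonneg n : (0 : ℝ) ≤ n)]
    refine ⟨n + 1, fun i => i * δ, by simp, by simpa using hnδ, fun i _ => ?_, fun i hi => ?_⟩
    · push_cast
      linarith
    refine ⟨_, hn, ?_⟩
    have hsub : Ioo ((i : ℝ) * δ) (((i + 1 : ℕ) : ℝ) * δ) ⊆ Ioo 0 T := by
      refine Ioo_subset_Ioo (by positivity) ?_
      rw [← hnδ]
      gcongr
      exact_mod_cast hi
    filter_upwards [ae_restrict_of_ae_restrict_of_subset hsub hC,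
      ae_restrict_mem measurableSet_Ioo] with t ht hti
    refine sqrt_setIntegral_convolution_kernel_le
      (hf₁L2.mono_set (Ioo_subset_Ioo_right hδT)) ?_ ht
    push_cast
    linarith [hti.1]
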